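/- Let ρ₀, ρ₁ ∈ M₊(Ω) with ρ₀(Ω) = ρ₁(Ω). Then the functional J_{ρ₀,ρ₁} attains its infimum on M([0,1]×Ω) × M([0,1]×Ω;ℝ^d), and the minimal value equals (1/2)·W₂(ρ₀,ρ₁)². -/

import Mathlib

open MeasureTheory Set Filter Topology
open scoped ENNReal NNReal

noncomputable section

abbrev Euc (d : ℕ) : Type := EuclideanSpace ℝ (Fin d)

/-- Integral of a function against a finite signed measure. -/
def sInt {X : Type*} [MeasurableSpace X] (ν : SignedMeasure X) (f : X → ℝ) : ℝ :=
  (∫ x, f x ∂ν.toJordanDecomposition.posPart) - ∫ x, f x ∂ν.toJordanDecomposition.negPart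

/-- Total variation norm of a finite signed measure. -/
def sTV {X : Type*} [MeasurableSpace X] (ν : SignedMeasure X) : ℝ :=
  (ν.totalVariation Set.univ).toReal

/-- Pairing of an `ℝ^d`-valued measure (given componentwise) with a vector field. -/
def vInt {X : Type*} [MeasurableSpace X] {d : ℕ} (m : Fin d → SignedMeasure X)
    (b : X → Euc d) : ℝ :=
  ∑ i, sInt (m i) fun x => b x i

/-- Total variation norm of a vector measure, via duality with continuous fields. -/
def vTV {X : Type*} [MeasurableSpace X] [TopologicalSpace X] {d : ℕ}
    (m : Fin d → SignedMeasure X) : ℝ :=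
  ⨆ b : {b : C(X, Euc d) // ∀ x, ‖b x‖ ≤ 1}, vInt m fun x => (b : C(X, Euc d)) x

/-- The Benamou-Brenier action. -/
def actionBB {X : Type*} [MeasurableSpace X] [TopologicalSpace X] {d : ℕ}
    (ρ : SignedMeasure X) (m : Fin d → SignedMeasure X) : ℝ≥0∞ :=
  ⨆ p : {q : C(X, ℝ) × C(X, Euc d) // ∀ x, q.1 x + ‖q.2 x‖ ^ 2 / 2 ≤ 0},
    ENNReal.ofReal (sInt ρ (p : C(X, ℝ) × C(X, Euc d)).1 + vInt m (p : C(X, ℝ) × C(X, Euc d)).2)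

/-- The space-time domain `[0,1] × Ω`. -/
abbrev STt (d : ℕ) (Ω : Set (Euc d)) : Type := ↥(Icc (0:ℝ) 1) × ↥Ω

def STemb {d : ℕ} {Ω : Set (Euc d)} (p : STt d Ω) : ℝ × Euc d := ((p.1 : ℝ), (p.2 : Euc d))

/-- The (weak formulation of the) continuity equation with temporal boundary data `ρ₀, ρ₁`. -/
def CEeq (d : ℕ) (Ω : Set (Euc d)) (ρ₀ ρ₁ : SignedMeasure ↥Ω)
    (ρ : SignedMeasure (STt d Ω)) (m : Fin d → SignedMeasure (STt d Ω)) : Prop :=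
  ∀ φ : ℝ × Euc d → ℝ, ContDiff ℝ 1 φ →
    sInt ρ (fun p => fderiv ℝ φ (STemb p) (1, 0)) +
      ∑ i, sInt (m i) (fun p => fderiv ℝ φ (STemb p) (0, EuclideanSpace.single i 1)) =
    sInt ρ₁ (fun x => φ (1, (x : Euc d))) - sInt ρ₀ (fun x => φ (0, (x : Euc d)))

open scoped Classical in
/-- The functional `J_{ρ₀,ρ₁}`. -/
def Jfun (d : ℕ) (Ω : Set (Euc d)) (ρ₀ ρ₁ : SignedMeasure ↥Ω)
    (ρ : SignedMeasure (STt d Ω)) (m : Fin d → SignedMeasure (STt d Ω)) : ℝ≥0∞ :=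
  if CEeq d Ω ρ₀ ρ₁ ρ m then actionBB ρ m else ⊤

/-- The quadratic Wasserstein distance. -/
def W2 {d : ℕ} {Ω : Set (Euc d)} (μ ν : Measure ↥Ω) : ℝ :=
  Real.sqrt (sInf {c : ℝ | ∃ π : Measure (↥Ω × ↥Ω), IsFiniteMeasure π ∧
    π.map Prod.fst = μ ∧ π.map Prod.snd = ν ∧
    c = ∫ p, ‖(p.1 : Euc d) - (p.2 : Euc d)‖ ^ 2 ∂π})

section KantorovichDuality

/-- The dual values of pairs of potentials dominating the cost `h`. -/
def dualValues {X Y : Type*} [TopologicalSpace X] [MeasurableSpace X]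
    [TopologicalSpace Y] [MeasurableSpace Y] (μ : Measure X) (ν : Measure Y)
    (h : C(X × Y, ℝ)) : Set ℝ :=
  {r | ∃ (φ : C(X, ℝ)) (ψ : C(Y, ℝ)), (∀ x y, h (x, y) ≤ φ x + ψ y) ∧
    r = ∫ x, φ x ∂μ + ∫ y, ψ y ∂ν}

lemma dualValues_nonempty {X Y : Type*} [TopologicalSpace X] [CompactSpace X] [MeasurableSpace X]
    [TopologicalSpace Y] [CompactSpace Y] [MeasurableSpace Y] 
    (μ : Measure X) (ν : Measure Y) (h : C(X × Y, ℝ)) : (dualValues μ ν h).Nonempty :=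
  ⟨_, ContinuousMap.const _ ‖h‖, 0, fun x y => by
    simpa using (le_abs_self _).trans (h.norm_coe_le_norm (x, y)), rfl⟩

variable {X Y : Type*} [MetricSpace X] [CompactSpace X] [MeasurableSpace X] [BorelSpace X]
  [MetricSpace Y] [CompactSpace Y] [MeasurableSpace Y] [BorelSpace Y]

lemma Continuous.integrable_of_compactSpace {f : X → ℝ} (hf : Continuous f) (μ : Measure X)
    [IsFiniteMeasure μ] : Integrable f μ :=
  hf.integrable_of_hasCompactSupport (HasCompactSupport.of_compactSpace f)

variable (μ : Measure X) (ν : Measure Y) [IsFiniteMeasure μ] [IsFiniteMeasure ν]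

lemma const_le_integral_add_integral [Nonempty X] [Nonempty Y] (hμν : μ univ = ν univ)
    {φ : C(X, ℝ)} {ψ : C(Y, ℝ)} {k : ℝ} (h : ∀ x y, k ≤ φ x + ψ y) :
    k * μ.real univ ≤ ∫ x, φ x ∂μ + ∫ y, ψ y ∂ν := by
  obtain ⟨x₀, hx₀⟩ := φ.continuous.exists_forall_le_of_hasCompactSupport
    (HasCompactSupport.of_compactSpace φ)
  obtain ⟨y₀, hy₀⟩ := ψ.continuous.exists_forall_le_of_hasCompactSupport
    (HasCompactSupport.of_compactSpace ψ)
  have h1 : φ x₀ * μ.real univ ≤ ∫ x, φ x ∂μ := by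
    simpa [mul_comm] using integral_mono (integrable_const (φ x₀))
      (φ.continuous.integrable_of_compactSpace μ) hx₀
  have h2 : ψ y₀ * ν.real univ ≤ ∫ y, ψ y ∂ν := by
    simpa [mul_comm] using integral_mono (integrable_const (ψ y₀))
      (ψ.continuous.integrable_of_compactSpace ν) hy₀
  have h3 : ν.real univ = μ.real univ := by simp [measureReal_def, hμν]
  rw [h3] at h2
  have := mul_le_mul_of_nonneg_right (h x₀ y₀) (measureReal_nonneg (μ := μ) (s := univ))
  linarith

lemma bddBelow_dualValues [Nonempty X] [Nonempty Y] (hμν : μ univ = ν univ) (h : C(X × Y, ℝ)) :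
    BddBelow (dualValues μ ν h) := by
  refine ⟨-‖h‖ * μ.real univ, ?_⟩
  rintro _ ⟨φ, ψ, hle, rfl⟩
  refine const_le_integral_add_integral μ ν hμν fun x y => le_trans ?_ (hle x y)
  exact (abs_le.1 (h.norm_coe_le_norm (x, y))).1

lemma sInf_dualValues_add_le [Nonempty X] [Nonempty Y] (hμν : μ univ = ν univ)
    (h k : C(X × Y, ℝ)) :
    sInf (dualValues μ ν (h + k)) ≤ sInf (dualValues μ ν h) + sInf (dualValues μ ν k) := by
  rw [← sub_le_iff_le_add]
  refine le_csInf (dualValues_nonempty μ ν _) ?_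
  rintro _ ⟨φ, ψ, hle, rfl⟩
  rw [sub_le_comm]
  refine le_csInf (dualValues_nonempty μ ν _) ?_
  rintro _ ⟨φ', ψ', hle', rfl⟩
  rw [sub_le_iff_le_add]
  refine csInf_le (bddBelow_dualValues μ ν hμν _) ⟨φ' + φ, ψ' + ψ, fun x y => ?_, ?_⟩
  · have := hle x y
    have := hle' x y
    simp only [ContinuousMap.add_apply]
    linarith
  · simp only [ContinuousMap.add_apply]
    rw [integral_add (φ'.continuous.integrable_of_compactSpace μ)
        (φ.continuous.integrable_of_compactSpace μ),
      integral_add (ψ'.continuous.integrable_of_compactSpace ν)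
        (ψ.continuous.integrable_of_compactSpace ν)]
    ring

lemma sInf_dualValues_smul_le [Nonempty X] [Nonempty Y] (hμν : μ univ = ν univ)
    {c : ℝ} (hc : 0 < c) (h : C(X × Y, ℝ)) :
    sInf (dualValues μ ν (c • h)) ≤ c * sInf (dualValues μ ν h) := by
  rw [← div_le_iff₀' hc]
  refine le_csInf (dualValues_nonempty μ ν _) ?_
  rintro _ ⟨φ, ψ, hle, rfl⟩
  rw [div_le_iff₀' hc]
  refine csInf_le (bddBelow_dualValues μ ν hμν _) ⟨c • φ, c • ψ, fun x y => ?_, ?_⟩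
  · have := mul_le_mul_of_nonneg_left (hle x y) hc.le
    simp only [ContinuousMap.smul_apply, smul_eq_mul]
    linarith
  · simp only [ContinuousMap.smul_apply, smul_eq_mul, integral_const_mul]
    ring

lemma sInf_dualValues_smul [Nonempty X] [Nonempty Y] (hμν : μ univ = ν univ)
    {c : ℝ} (hc : 0 < c) (h : C(X × Y, ℝ)) :
    sInf (dualValues μ ν (c • h)) = c * sInf (dualValues μ ν h) := by
  refine le_antisymm (sInf_dualValues_smul_le μ ν hμν hc h) ?_
  have := sInf_dualValues_smul_le μ ν hμν (inv_pos.2 hc) (c • h)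
  rw [smul_smul, inv_mul_cancel₀ hc.ne', one_smul] at this
  rwa [← le_inv_mul_iff₀ hc]

/-- **Riesz representation** on a compact space, for a functional nonpositive on nonpositive
functions. -/
lemma exists_measure_of_nonpos (g : C(X, ℝ) →ₗ[ℝ] ℝ) (hg : ∀ h : C(X, ℝ), h ≤ 0 → g h ≤ 0) :
    ∃ π : Measure X, IsFiniteMeasure π ∧ ∀ h : C(X, ℝ), ∫ p, h p ∂π = g h := by
  let Λ : CompactlySupportedContinuousMap X ℝ →ₚ[ℝ] ℝ :=
  { toFun f := g f
    map_add' f f' := g.map_add (f : C(X, ℝ)) f'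
    map_smul' c f := g.map_smul c (f : C(X, ℝ))
    monotone' f f' hff' := by
      have := hg ((f : C(X, ℝ)) - (f' : C(X, ℝ))) fun x => by simpa using hff' x
      rw [map_sub] at this
      exact sub_nonpos.1 this }
  have hfin : IsFiniteMeasure (RealRMK.rieszMeasure Λ) :=
    ⟨(isCompact_univ.measure_lt_top)⟩
  exact ⟨_, hfin, fun h => RealRMK.integral_rieszMeasure Λ
    ⟨h, HasCompactSupport.of_compactSpace h⟩⟩

/-- **Kantorovich duality**: there is a coupling whose cost is bounded by any upper bound of the
dual problem. -/
theorem exists_coupling_forall_dual_le [Nonempty X] [Nonempty Y] (hμν : μ univ = ν univ)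
    (c : C(X × Y, ℝ)) :
    ∃ π : Measure (X × Y), IsFiniteMeasure π ∧ π.map Prod.fst = μ ∧ π.map Prod.snd = ν ∧
      ∀ B : ℝ, (∀ (φ : C(X, ℝ)) (ψ : C(Y, ℝ)), (∀ x y, φ x + ψ y ≤ c (x, y)) →
        ∫ x, φ x ∂μ + ∫ y, ψ y ∂ν ≤ B) → ∫ p, c p ∂π ≤ B := by
  set N : C(X × Y, ℝ) → ℝ := fun h => sInf (dualValues μ ν h) with hN
  have hNadd : ∀ h k, N (h + k) ≤ N h + N k := sInf_dualValues_add_le μ ν hμν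
  have hNle : ∀ (h : C(X × Y, ℝ)) (φ : C(X, ℝ)) (ψ : C(Y, ℝ)),
      (∀ x y, h (x, y) ≤ φ x + ψ y) → N h ≤ ∫ x, φ x ∂μ + ∫ y, ψ y ∂ν := fun h φ ψ hle =>
    csInf_le (bddBelow_dualValues μ ν hμν h) ⟨φ, ψ, hle, rfl⟩
  have hN0 : N 0 = 0 := by
    have := sInf_dualValues_smul μ ν hμν (two_pos) (0 : C(X × Y, ℝ))
    rw [smul_zero] at this
    simp only [hN]
    linarith
  have hdom : ∀ t : ℝ, t * N (-c) ≤ N (t • -c) := by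
    intro t
    rcases lt_trichotomy t 0 with ht | rfl | ht
    · have h1 := hNadd (t • -c) ((-t) • -c)
      rw [← add_smul, add_neg_cancel, zero_smul, hN0] at h1
      have h2 : N ((-t) • -c) = -t * N (-c) := sInf_dualValues_smul μ ν hμν (neg_pos.2 ht) _
      linarith
    · simp [hN0]
    · exact (sInf_dualValues_smul μ ν hμν ht _).ge
  obtain ⟨g, hgf, hgN⟩ := exists_extension_of_le_sublinear
    (LinearPMap.mkSpanSingleton' (σ := RingHom.id ℝ) (-c) (N (-c)) (by
      intro t ht
      rcases smul_eq_zero.1 ht with rfl | h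
      · simp
      · simp [h, hN0])) N (fun t ht h => sInf_dualValues_smul μ ν hμν ht h) hNadd (by
      rintro ⟨x, hx⟩
      obtain ⟨t, rfl⟩ := Submodule.mem_span_singleton.1 hx
      rw [LinearPMap.mkSpanSingleton'_apply]
      exact hdom t)
  have hgc : g (-c) = N (-c) := by
    rw [hgf ⟨-c, Submodule.mem_span_singleton_self _⟩]
    exact LinearPMap.mkSpanSingleton'_apply_self _ _ _ _
  obtain ⟨π, hπ, hint⟩ := exists_measure_of_nonpos g fun h hh => by
    refine (hgN h).trans ((hNle h 0 0 fun x y => by simpa using hh (x, y)).trans (by simp))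
  have hsplit : ∀ (φ : C(X, ℝ)) (ψ : C(Y, ℝ)),
      g (φ.comp ContinuousMap.fst + ψ.comp ContinuousMap.snd) =
        ∫ x, φ x ∂μ + ∫ y, ψ y ∂ν := by
    intro φ ψ
    refine le_antisymm ((hgN _).trans (hNle _ φ ψ fun x y => le_rfl)) ?_
    have := (hgN (-(φ.comp ContinuousMap.fst + ψ.comp ContinuousMap.snd))).trans
      (hNle _ (-φ) (-ψ) fun x y => (neg_add (φ x) (ψ y)).le)
    simp only [map_neg, ContinuousMap.neg_apply, integral_neg] at this
    linarith
  refine ⟨π, hπ, ?_, ?_, fun B hB => ?_⟩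
  · refine ext_of_forall_integral_eq_of_IsFiniteMeasure fun f => ?_
    rw [integral_map measurable_fst.aemeasurable f.continuous.aestronglyMeasurable]
    simpa [← hint] using hsplit f.toContinuousMap 0
  · refine ext_of_forall_integral_eq_of_IsFiniteMeasure fun f => ?_
    rw [integral_map measurable_snd.aemeasurable f.continuous.aestronglyMeasurable]
    simpa [← hint] using hsplit 0 f.toContinuousMap
  · have h1 : -B ≤ N (-c) := by
      refine le_csInf (dualValues_nonempty μ ν _) ?_
      rintro _ ⟨φ, ψ, hle, rfl⟩
      have := hB (-φ) (-ψ) fun x y => by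
        have := hle x y
        simp only [ContinuousMap.neg_apply] at this ⊢
        linarith
      simp only [ContinuousMap.neg_apply, integral_neg] at this
      linarith
    rw [hint]
    rw [← hgc, map_neg] at h1
    linarith

end KantorovichDuality

section SignedIntegrals

variable {X : Type*} [MeasurableSpace X]

lemma sInt_toSignedMeasure_sub (μ ν : Measure X) [IsFiniteMeasure μ] [IsFiniteMeasure ν]
    {f : X → ℝ} (hμ : Integrable f μ) (hν : Integrable f ν) :
    sInt (μ.toSignedMeasure - ν.toSignedMeasure) f = ∫ x, f x ∂μ - ∫ x, f x ∂ν := by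
  have hJ := congrArg JordanDecomposition.toSignedMeasure
    (Measure.toJordanDecomposition_toSignedMeasure_sub (μ := μ) (ν := ν))
  rw [SignedMeasure.toSignedMeasure_toJordanDecomposition] at hJ
  set j := (μ.toSignedMeasure - ν.toSignedMeasure).toJordanDecomposition with hj
  have hp : j.posPart = μ - ν := by
    rw [hj, Measure.toJordanDecomposition_toSignedMeasure_sub]
    rfl
  have hn : j.negPart = ν - μ := by
    rw [hj, Measure.toJordanDecomposition_toSignedMeasure_sub]
    rfl
  have hadd : j.posPart + ν = μ + j.negPart := by
    rw [← Measure.toSignedMeasure_eq_toSignedMeasure_iff, Measure.toSignedMeasure_add,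
      Measure.toSignedMeasure_add]
    have : j.posPart.toSignedMeasure - j.negPart.toSignedMeasure =
        μ.toSignedMeasure - ν.toSignedMeasure :=
      SignedMeasure.toSignedMeasure_toJordanDecomposition _
    rwa [sub_eq_sub_iff_add_eq_add] at this
  have hjp : Integrable f j.posPart := hμ.mono_measure (hp ▸ Measure.sub_le)
  have hjn : Integrable f j.negPart := hν.mono_measure (hn ▸ Measure.sub_le)
  have := congrArg (integral · f) hadd
  rw [integral_add_measure hjp hν, integral_add_measure hμ hjn] at this
  simp only [sInt, ← hj]
  linarith

lemma sInt_toSignedMeasure (μ : Measure X) [IsFiniteMeasure μ] {f : X → ℝ}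
    (hμ : Integrable f μ) : sInt μ.toSignedMeasure f = ∫ x, f x ∂μ := by
  simpa using sInt_toSignedMeasure_sub μ 0 hμ (integrable_zero_measure)

/-- Pushforward by `T` of the signed measure with density `v` with respect to `κ`. -/
lemma exists_sInt_eq_integral_mul_comp {Z Y : Type*}
    [TopologicalSpace Z] [CompactSpace Z] [MeasurableSpace Z] [OpensMeasurableSpace Z]
    [MetricSpace Y] [CompactSpace Y] [MeasurableSpace Y] [BorelSpace Y]
    (κ : Measure Z) [IsFiniteMeasure κ] (v : C(Z, ℝ)) (T : C(Z, Y)) :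
    ∃ s : SignedMeasure Y, ∀ f : C(Y, ℝ), sInt s f = ∫ z, v z * f (T z) ∂κ := by
  have hZ : ∀ g : C(Z, ℝ), Integrable g κ := fun g =>
    g.continuous.integrable_of_hasCompactSupport (HasCompactSupport.of_compactSpace g)
  have hfin := isFiniteMeasure_withDensity_ofReal (hZ v).hasFiniteIntegral
  have hfin' := isFiniteMeasure_withDensity_ofReal (hZ (-v)).hasFiniteIntegral
  refine ⟨((κ.withDensity fun z => ENNReal.ofReal (v z)).map T).toSignedMeasure -
    ((κ.withDensity fun z => ENNReal.ofReal ((-v) z)).map T).toSignedMeasure, fun f => ?_⟩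
  rw [sInt_toSignedMeasure_sub _ _ (f.continuous.integrable_of_compactSpace _)
    (f.continuous.integrable_of_compactSpace _),
    integral_map T.measurable.aemeasurable f.continuous.aestronglyMeasurable,
    integral_map T.measurable.aemeasurable f.continuous.aestronglyMeasurable,
    integral_withDensity_eq_integral_toReal_smul v.measurable.ennreal_ofReal
      (Eventually.of_forall fun _ => ENNReal.ofReal_lt_top),
    integral_withDensity_eq_integral_toReal_smul (-v).measurable.ennreal_ofReal
      (Eventually.of_forall fun _ => ENNReal.ofReal_lt_top), ← integral_sub]
  · congr 1 with z
    simp only [ENNReal.toReal_ofReal', smul_eq_mul, ContinuousMap.neg_apply]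
    rcases le_total 0 (v z) with h | h
    · rw [max_eq_left h, max_eq_right (by linarith)]
      ring
    · rw [max_eq_right h, max_eq_left (by linarith)]
      ring
  · refine (hZ ⟨fun z => max (v z) 0 * f (T z), by fun_prop⟩).congr (ae_of_all _ fun z => ?_)
    simp [ENNReal.toReal_ofReal']
  · refine (hZ ⟨fun z => max (-v z) 0 * f (T z), by fun_prop⟩).congr (ae_of_all _ fun z => ?_)
    simp [ENNReal.toReal_ofReal']

end SignedIntegrals

section DisplacementInterpolation

variable {d : ℕ} {Ω : Set (Euc d)}

/-- The displacement interpolation `(t, x, y) ↦ (t, (1 - t) x + t y)`. -/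
def displacement (hconv : Convex ℝ Ω) : C(↥(Icc (0:ℝ) 1) × (↥Ω × ↥Ω), STt d Ω) where
  toFun z := (z.1, ⟨(1 - (z.1 : ℝ)) • (z.2.1 : Euc d) + (z.1 : ℝ) • (z.2.2 : Euc d),
    hconv z.2.1.2 z.2.2.2 (by linarith [z.1.2.2]) z.1.2.1 (by ring)⟩)
  continuous_toFun := by fun_prop

lemma integral_fderiv_displacement (hconv : Convex ℝ Ω) {φ : ℝ × Euc d → ℝ}
    (hφ : ContDiff ℝ 1 φ) (q : ↥Ω × ↥Ω) :
    ∫ t : ↥(Icc (0:ℝ) 1), fderiv ℝ φ (STemb (displacement hconv (t, q)))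
      (1, (q.2 : Euc d) - (q.1 : Euc d)) = φ (1, (q.2 : Euc d)) - φ (0, (q.1 : Euc d)) := by
  set γ : ℝ → ℝ × Euc d := fun t => (t, (1 - t) • (q.1 : Euc d) + t • (q.2 : Euc d)) with hγ
  have hγ' : ∀ t, HasDerivAt γ (1, (q.2 : Euc d) - (q.1 : Euc d)) t := by
    intro t
    refine (hasDerivAt_id t).prodMk ?_
    have h1 := ((hasDerivAt_id t).const_sub 1).smul_const (q.1 : Euc d)
    have h2 := (hasDerivAt_id t).smul_const (q.2 : Euc d)
    exact (h1.add h2).congr_deriv (by simp [sub_eq_neg_add])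
  have hγc : Continuous γ := by fun_prop
  have hcont : Continuous fun t => fderiv ℝ φ (γ t) (1, (q.2 : Euc d) - (q.1 : Euc d)) :=
    ((hφ.continuous_fderiv one_ne_zero).comp hγc).clm_apply continuous_const
  have hsub : ∫ t : ↥(Icc (0:ℝ) 1), fderiv ℝ φ (STemb (displacement hconv (t, q)))
      (1, (q.2 : Euc d) - (q.1 : Euc d)) =
      ∫ t in Icc (0:ℝ) 1, fderiv ℝ φ (γ t) (1, (q.2 : Euc d) - (q.1 : Euc d)) :=
    integral_subtype_comap measurableSet_Icc
      fun t => fderiv ℝ φ (γ t) (1, (q.2 : Euc d) - (q.1 : Euc d))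
  rw [hsub, integral_Icc_eq_integral_Ioc, ← intervalIntegral.integral_of_le zero_le_one,
    intervalIntegral.integral_eq_sub_of_hasDerivAt (f := φ ∘ γ) (fun t _ =>
      ((hφ.differentiable one_ne_zero _).hasFDerivAt.comp_hasDerivAt t (hγ' t)))
      (hcont.intervalIntegrable _ _)]
  simp [hγ]

lemma fderiv_one_prod_apply (L : ℝ × Euc d →L[ℝ] ℝ) (v : Euc d) :
    L (1, v) = L (1, 0) + ∑ i, v i * L (0, EuclideanSpace.single i 1) := by
  have hv : v = ∑ i, v i • EuclideanSpace.single i (1:ℝ) := by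
    ext j
    simp [Finset.sum_apply, Pi.single_apply]
  have h1 : ((1:ℝ), v) = (1, 0) + ∑ i, v i • ((0:ℝ), EuclideanSpace.single i (1:ℝ)) := by
    ext1
    · simp [Prod.fst_sum]
    · simp only [Prod.snd_add, Prod.snd_sum, Prod.smul_mk, zero_add]
      exact hv
  simp only [h1, map_add, map_sum, map_smul, smul_eq_mul]

/-- The displacement interpolation of a coupling solves the continuity equation, with action
bounded by half of the transport cost. -/
theorem exists_CEeq_actionBB_le [CompactSpace ↥Ω] (hconv : Convex ℝ Ω) (ρ₀ ρ₁ : Measure ↥Ω)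
    [IsFiniteMeasure ρ₀] [IsFiniteMeasure ρ₁] (π : Measure (↥Ω × ↥Ω)) [IsFiniteMeasure π]
    (h₀ : π.map Prod.fst = ρ₀) (h₁ : π.map Prod.snd = ρ₁) :
    ∃ (ρ : SignedMeasure (STt d Ω)) (m : Fin d → SignedMeasure (STt d Ω)),
      CEeq d Ω ρ₀.toSignedMeasure ρ₁.toSignedMeasure ρ m ∧
      actionBB ρ m ≤
        ENNReal.ofReal ((∫ p, ‖(p.1 : Euc d) - (p.2 : Euc d)‖ ^ 2 ∂π) / 2) := by
  set κ : Measure (↥(Icc (0:ℝ) 1) × (↥Ω × ↥Ω)) := volume.prod π with hκ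
  have hint : ∀ {g : ↥(Icc (0:ℝ) 1) × (↥Ω × ↥Ω) → ℝ}, Continuous g → Integrable g κ := fun hg =>
    hg.integrable_of_compactSpace κ
  set T := displacement hconv with hT
  obtain ⟨ρ, hρ⟩ := exists_sInt_eq_integral_mul_comp κ (ContinuousMap.const _ 1) T
  choose m hm using fun i : Fin d => exists_sInt_eq_integral_mul_comp κ
    ⟨fun z => ((z.2.2 : Euc d) - (z.2.1 : Euc d)) i, by fun_prop⟩ T
  have hpair : ∀ (a : C(STt d Ω, ℝ)) (b : Fin d → C(STt d Ω, ℝ)),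
      sInt ρ a + ∑ i, sInt (m i) (b i) =
        ∫ z, (a (T z) + ∑ i, ((z.2.2 : Euc d) - (z.2.1 : Euc d)) i * b i (T z)) ∂κ := by
    intro a b
    rw [integral_add (hint (by fun_prop)) (hint (by fun_prop)),
      integral_finsetSum _ fun i _ => hint (by fun_prop), hρ]
    simp only [hm]
    simp
  refine ⟨ρ, m, fun φ hφ => ?_, iSup_le fun p => ENNReal.ofReal_le_ofReal ?_⟩
  · have hST : Continuous (STemb : STt d Ω → ℝ × Euc d) := by unfold STemb; fun_prop
    have hd : ∀ w, Continuous fun p : STt d Ω => fderiv ℝ φ (STemb p) w := fun w =>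
      ((hφ.continuous_fderiv one_ne_zero).comp hST).clm_apply continuous_const
    have h := hpair ⟨_, hd (1, 0)⟩ fun i => ⟨_, hd (0, EuclideanSpace.single i 1)⟩
    simp only [ContinuousMap.coe_mk] at h
    rw [h]
    simp only [← fderiv_one_prod_apply]
    have hfst : Continuous fun x : ↥Ω => φ (0, (x : Euc d)) := hφ.continuous.comp (by fun_prop)
    have hsnd : Continuous fun x : ↥Ω => φ (1, (x : Euc d)) := hφ.continuous.comp (by fun_prop)
    rw [sInt_toSignedMeasure _ (hsnd.integrable_of_compactSpace _),
      sInt_toSignedMeasure _ (hfst.integrable_of_compactSpace _), hκ,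
      integral_prod_symm]
    · simp only [hT, integral_fderiv_displacement hconv hφ]
      rw [integral_sub, ← h₀, ← h₁, integral_map measurable_fst.aemeasurable
        hfst.aestronglyMeasurable, integral_map measurable_snd.aemeasurable
        hsnd.aestronglyMeasurable]
      · exact (hsnd.comp continuous_snd).integrable_of_compactSpace _
      · exact (hfst.comp continuous_fst).integrable_of_compactSpace _
    · exact hint (((hφ.continuous_fderiv one_ne_zero).comp (hST.comp T.continuous)).clm_apply
        (by fun_prop))
  · obtain ⟨⟨a, b⟩, hab⟩ := p
    have h := hpair a fun i => ⟨fun x => b x i, by fun_prop⟩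
    simp only [ContinuousMap.coe_mk] at h
    simp only [vInt]
    rw [h, ← integral_div]
    have hpt : ∀ z : ↥(Icc (0:ℝ) 1) × (↥Ω × ↥Ω),
        a (T z) + ∑ i, ((z.2.2 : Euc d) - (z.2.1 : Euc d)) i * b (T z) i ≤
          ‖(z.2.1 : Euc d) - (z.2.2 : Euc d)‖ ^ 2 / 2 := by
      intro z
      have h1 := hab (T z)
      have h2 : ∑ i, ((z.2.2 : Euc d) - (z.2.1 : Euc d)) i * b (T z) i =
          inner ℝ (b (T z)) ((z.2.2 : Euc d) - (z.2.1 : Euc d)) := by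
        simp [PiLp.inner_apply]
      have h3 := real_inner_le_norm (b (T z)) ((z.2.2 : Euc d) - (z.2.1 : Euc d))
      simp only at h1
      rw [h2, norm_sub_rev (z.2.1 : Euc d)]
      nlinarith [sq_nonneg (‖b (T z)‖ - ‖(z.2.2 : Euc d) - (z.2.1 : Euc d)‖)]
    refine (integral_mono (hint (by fun_prop)) (hint (by fun_prop)) hpt).trans_eq ?_
    rw [hκ, integral_prod_symm _ (hint (by fun_prop))]
    simp

end DisplacementInterpolation

section SoftMin

variable {ι E : Type*}

/-- A smooth approximation from below of the minimum of the functions `w i`, `i ∈ S`. -/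
def softMin (δ : ℝ) (S : Finset ι) (w : ι → E → ℝ) (p : E) : ℝ :=
  -δ * Real.log (∑ i ∈ S, Real.exp (-(w i p) / δ))

variable {δ : ℝ} {S : Finset ι} {w : ι → E → ℝ}

lemma sum_exp_pos (hS : S.Nonempty) (p : E) : 0 < ∑ i ∈ S, Real.exp (-(w i p) / δ) :=
  Finset.sum_pos (fun _ _ => Real.exp_pos _) hS

lemma softMin_le (hδ : 0 < δ) {i : ι} (hi : i ∈ S) (p : E) : softMin δ S w p ≤ w i p := by
  have h1 : Real.exp (-(w i p) / δ) ≤ ∑ i ∈ S, Real.exp (-(w i p) / δ) :=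
    Finset.single_le_sum (f := fun i => Real.exp (-(w i p) / δ))
      (fun _ _ => (Real.exp_pos _).le) hi
  have h2 := Real.log_le_log (Real.exp_pos _) h1
  rw [Real.log_exp, div_le_iff₀ hδ] at h2
  simp only [softMin]
  linarith

lemma le_softMin (hδ : 0 < δ) (hS : S.Nonempty) {p : E} {k : ℝ} (hk : ∀ i ∈ S, k ≤ w i p) :
    k - δ * Real.log S.card ≤ softMin δ S w p := by
  have h1 : ∑ i ∈ S, Real.exp (-(w i p) / δ) ≤ S.card * Real.exp (-k / δ) := by
    rw [← nsmul_eq_mul]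
    refine Finset.sum_le_card_nsmul _ _ _ fun i hi => Real.exp_le_exp.2 ?_
    exact div_le_div_of_nonneg_right (neg_le_neg (hk i hi)) hδ.le
  have h2 := Real.log_le_log (sum_exp_pos hS p) h1
  rw [Real.log_mul (by simpa using hS.ne_empty) (Real.exp_pos _).ne', Real.log_exp] at h2
  have h3 := mul_le_mul_of_nonneg_left h2 hδ.le
  rw [mul_add, mul_div_cancel₀ _ hδ.ne'] at h3
  simp only [softMin]
  linarith

variable [NormedAddCommGroup E] [NormedSpace ℝ E]

lemma contDiff_softMin (hS : S.Nonempty) (hw : ∀ i, ContDiff ℝ 1 (w i)) :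
    ContDiff ℝ 1 (softMin δ S w) := by
  refine contDiff_const.mul (ContDiff.log (ContDiff.sum fun i _ => ?_)
    fun p => (sum_exp_pos hS p).ne')
  exact ((hw i).neg.div_const δ).exp

/-- The differential of a soft minimum is a convex combination of the differentials. -/
lemma exists_weights_fderiv_softMin (hδ : 0 < δ) (hS : S.Nonempty)
    (hw : ∀ i, ContDiff ℝ 1 (w i)) (p : E) :
    ∃ θ : ι → ℝ, (∀ i, 0 ≤ θ i) ∧ ∑ i ∈ S, θ i = 1 ∧
      ∀ v, fderiv ℝ (softMin δ S w) p v = ∑ i ∈ S, θ i * fderiv ℝ (w i) p v := by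
  have hZ := sum_exp_pos (w := w) (δ := δ) hS p
  set Z := ∑ i ∈ S, Real.exp (-(w i p) / δ) with hZdef
  refine ⟨fun i => Real.exp (-(w i p) / δ) / Z, fun i => by positivity, ?_, fun v => ?_⟩
  · rw [← Finset.sum_div, div_self hZ.ne']
  · have hwi : ∀ i, HasFDerivAt (w i) (fderiv ℝ (w i) p) p := fun i =>
      ((hw i).differentiable one_ne_zero p).hasFDerivAt
    have hs : HasFDerivAt (fun q => ∑ i ∈ S, Real.exp (-(w i q) / δ)) _ p :=
      HasFDerivAt.fun_sum fun i _ => (((hwi i).fun_neg.mul_const δ⁻¹)).exp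
    have h := (hs.log hZ.ne').const_mul (-δ)
    have h' : HasFDerivAt (softMin δ S w) _ p := h
    rw [h'.fderiv]
    simp only [_root_.smul_apply, _root_.sum_apply, _root_.neg_apply, smul_eq_mul, Finset.mul_sum, ← hZdef]
    refine Finset.sum_congr rfl fun i _ => ?_
    field_simp

end SoftMin

section HamiltonJacobi

/-- A function smooth on the whole line that solves a Riccati equation for nonnegative
times. -/
lemma exists_contDiff_riccati {τ : ℝ} (hτ : 0 < τ) :
    ∃ g : ℝ → ℝ, ContDiff ℝ 1 g ∧ ∀ t, 0 ≤ t → g t = (t + τ)⁻¹ ∧ HasDerivAt g (-(g t) ^ 2) t := by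
  have h_one : ∀ t, -τ / 2 ≤ t → Real.smoothTransition (4 * t / τ + 3) = 1 := fun t ht => by
    refine Real.smoothTransition.one_of_one_le ?_
    have : -2 ≤ 4 * t / τ := by rw [le_div_iff₀ hτ]; linarith
    linarith
  have h_zero : ∀ t, t ≤ -(3 * τ / 4) → Real.smoothTransition (4 * t / τ + 3) = 0 := fun t ht => by
    refine Real.smoothTransition.zero_of_nonpos ?_
    have : 4 * t / τ ≤ -3 := by rw [div_le_iff₀ hτ]; linarith
    linarith
  refine ⟨fun t => Real.smoothTransition (4 * t / τ + 3) * (t + τ)⁻¹, ?_, fun t ht => ?_⟩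
  · rw [contDiff_iff_contDiffAt]
    intro t
    rcases lt_or_ge t (-(3 * τ / 4)) with h | h
    · refine (contDiffAt_const (c := (0:ℝ))).congr_of_eventuallyEq ?_
      filter_upwards [Iio_mem_nhds h] with s hs
      simp only [h_zero s (mem_Iio.1 hs).le, zero_mul]
    · refine ContDiffAt.mul (Real.smoothTransition.contDiffAt.comp t ?_)
        (ContDiffAt.inv (by fun_prop) (by linarith))
      fun_prop
  · have ht' : t + τ ≠ 0 := by linarith
    have heq : (fun t => Real.smoothTransition (4 * t / τ + 3) * (t + τ)⁻¹) =ᶠ[𝓝 t]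
        fun t => (t + τ)⁻¹ := by
      filter_upwards [Ioi_mem_nhds (show -τ / 2 < t by linarith)] with s hs
      rw [h_one s (mem_Ioi.1 hs).le, one_mul]
    have hval := heq.eq_of_nhds
    refine ⟨hval, ?_⟩
    have := (((hasDerivAt_id t).add_const τ).inv ht').congr_of_eventuallyEq heq
    refine this.congr_deriv ?_
    simp only [hval]
    simp [neg_div]

variable {d : ℕ}

/-- Smooth subsolutions of the Hamilton-Jacobi equation interpolating between two potentials for
the quadratic cost. -/
lemma exists_hamiltonJacobi_subsolution {Ω : Set (Euc d)} [CompactSpace ↥Ω] [Nonempty ↥Ω]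
    (φ ψ : C(↥Ω, ℝ)) (hle : ∀ x y, φ x + ψ y ≤ ‖(x : Euc d) - (y : Euc d)‖ ^ 2 / 2)
    {ε : ℝ} (hε : 0 < ε) :
    ∃ u : ℝ × Euc d → ℝ, ContDiff ℝ 1 u ∧
      (∀ (t : ℝ) (x : Euc d), 0 ≤ t → fderiv ℝ u (t, x) (1, 0) +
        ‖WithLp.toLp 2 fun i => fderiv ℝ u (t, x) (0, EuclideanSpace.single i 1)‖ ^ 2 / 2 ≤ 0) ∧
      (∀ x : ↥Ω, u (0, (x : Euc d)) ≤ -φ x + ε) ∧ ∀ y : ↥Ω, ψ y - ε ≤ u (1, (y : Euc d)) := by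
  obtain ⟨C, hC0, hC⟩ : ∃ C : ℝ, 0 ≤ C ∧
      ∀ x y : ↥Ω, ‖(x : Euc d) - (y : Euc d)‖ ^ 2 ≤ C := by
    let c : C(↥Ω × ↥Ω, ℝ) := ⟨fun p => ‖(p.1 : Euc d) - (p.2 : Euc d)‖ ^ 2, by fun_prop⟩
    exact ⟨‖c‖, norm_nonneg _, fun x y => (le_abs_self _).trans (c.norm_coe_le_norm (x, y))⟩
  set τ := ε / (C + 1) with hτdef
  have hτ : 0 < τ := by positivity
  have hτC : τ * C ≤ ε := by
    rw [hτdef, div_mul_eq_mul_div, div_le_iff₀ (by positivity)]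
    nlinarith
  obtain ⟨g, hg, hgt⟩ := exists_contDiff_riccati hτ
  obtain ⟨r₀, hr₀, hφr⟩ := Metric.uniformContinuous_iff.1
    (CompactSpace.uniformContinuous_of_continuous φ.continuous) (ε / 2) (by positivity)
  set r := min r₀ (Real.sqrt (τ * ε)) with hr
  have hrpos : 0 < r := lt_min hr₀ (Real.sqrt_pos.2 (by positivity))
  have hr2 : r ^ 2 ≤ τ * ε := by
    rw [← Real.sq_sqrt (show 0 ≤ τ * ε by positivity)]
    exact pow_le_pow_left₀ hrpos.le (min_le_right _ _) 2
  obtain ⟨S₀, -, hS₀fin, hS₀⟩ := finite_cover_balls_of_compact (isCompact_univ (X := ↥Ω)) hrpos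
  set S := hS₀fin.toFinset with hSdef
  have hnet : ∀ x : ↥Ω, ∃ y ∈ S, dist x y < r := fun x => by
    simpa [hSdef] using hS₀ (mem_univ x)
  have hS : S.Nonempty := by
    obtain ⟨y, hy, -⟩ := hnet (Classical.arbitrary _)
    exact ⟨y, hy⟩
  have hlog : 0 ≤ Real.log S.card := Real.log_natCast_nonneg _
  set δ := ε / (2 * (Real.log S.card + 1)) with hδdef
  have hδ : 0 < δ := by positivity
  have hδlog : δ * Real.log S.card ≤ ε / 2 := by
    rw [hδdef, div_mul_eq_mul_div, div_le_iff₀ (by positivity)]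
    nlinarith
  set w : ↥Ω → ℝ × Euc d → ℝ := fun y p => -φ y + g p.1 * (‖p.2 - (y : Euc d)‖ ^ 2 / 2) with hw
  have hwC : ∀ y, ContDiff ℝ 1 (w y) := fun y => contDiff_const.add
    ((hg.comp contDiff_fst).mul (((contDiff_snd.sub contDiff_const).norm_sq ℝ).div_const 2))
  have hwd : ∀ (y : ↥Ω) (t : ℝ) (x : Euc d), 0 ≤ t → ∀ v : ℝ × Euc d,
      fderiv ℝ (w y) (t, x) v = -(g t) ^ 2 * (‖x - (y : Euc d)‖ ^ 2 / 2) * v.1 +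
        g t * inner ℝ (x - (y : Euc d)) v.2 := by
    intro y t x ht v
    have h1 := HasDerivAt.comp_hasFDerivAt (f := Prod.fst) (t, x) (hgt t ht).2
      (hasFDerivAt_fst (𝕜 := ℝ) (E := ℝ) (F := Euc d))
    have h2 := ((hasFDerivAt_snd (𝕜 := ℝ) (E := ℝ) (F := Euc d) (p := (t, x))).sub_const
      (y : Euc d)).norm_sq.mul_const (2:ℝ)⁻¹
    have h3 : HasFDerivAt (w y) _ (t, x) := (h1.mul h2).const_add (-φ y)
    rw [h3.fderiv]
    simp [inner_sub_left]
    ring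
  refine ⟨softMin δ S w, contDiff_softMin hS hwC, fun t x ht => ?_, fun x => ?_, fun y => ?_⟩
  · obtain ⟨θ, hθ0, hθ1, hθ⟩ := exists_weights_fderiv_softMin hδ hS hwC (t, x)
    have hgrad : (WithLp.toLp 2 fun i => fderiv ℝ (softMin δ S w) (t, x)
        (0, EuclideanSpace.single i 1) : Euc d) = ∑ y ∈ S, θ y • (g t • (x - (y : Euc d))) := by
      ext i
      simp [hθ, hwd _ t x ht, Finset.sum_apply, EuclideanSpace.inner_single_right]
    have hconv : ‖∑ y ∈ S, θ y • (g t • (x - (y : Euc d)))‖ ^ 2 ≤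
        ∑ y ∈ S, θ y * ‖g t • (x - (y : Euc d))‖ ^ 2 :=
      ((convexOn_univ_norm (E := Euc d)).pow (fun _ _ => norm_nonneg _) 2).map_sum_le
        (fun y _ => hθ0 y) hθ1 (fun _ _ => mem_univ _)
    rw [hgrad, hθ]
    have heq : ∑ y ∈ S, θ y * fderiv ℝ (w y) (t, x) (1, 0) =
        -((∑ y ∈ S, θ y * ‖g t • (x - (y : Euc d))‖ ^ 2) / 2) := by
      rw [Finset.sum_div, ← Finset.sum_neg_distrib]
      refine Finset.sum_congr rfl fun y _ => ?_
      rw [hwd _ t x ht, norm_smul, mul_pow, Real.norm_eq_abs, sq_abs]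
      simp
      ring
    rw [heq]
    linarith
  · obtain ⟨y, hy, hxy⟩ := hnet x
    refine (softMin_le hδ hy _).trans ?_
    have h1 := hφr (hxy.trans_le (min_le_left _ _))
    rw [Real.dist_eq] at h1
    have h2 : ‖(x : Euc d) - (y : Euc d)‖ ^ 2 ≤ τ * ε := by
      rw [← dist_eq_norm]
      exact (pow_le_pow_left₀ dist_nonneg hxy.le 2).trans hr2
    have h3 : τ⁻¹ * (‖(x : Euc d) - (y : Euc d)‖ ^ 2 / 2) ≤ ε / 2 := by
      rw [inv_mul_le_iff₀ hτ]
      linarith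
    simp only [hw, (hgt 0 le_rfl).1, zero_add]
    linarith [(abs_lt.1 h1).2]
  · refine le_trans ?_ (le_softMin (k := ψ y - ε / 2) hδ hS fun x _ => ?_)
    · linarith
    · simp only [hw, (hgt 1 zero_le_one).1]
      have h1 := hle x y
      rw [norm_sub_rev] at h1
      have h2 := hC y x
      have h3 : 1 - τ ≤ (1 + τ)⁻¹ := by
        rw [← one_div, le_div_iff₀ (by positivity)]
        nlinarith
      have h4 := mul_le_mul_of_nonneg_right h3
        (show 0 ≤ ‖(y : Euc d) - (x : Euc d)‖ ^ 2 / 2 by positivity)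
      have h5 := mul_le_mul_of_nonneg_left h2 hτ.le
      linarith

/-- Any admissible pair of Kantorovich potentials bounds the action of a solution of the continuity
equation from below. -/
theorem ofReal_dual_le_actionBB {Ω : Set (Euc d)} [CompactSpace ↥Ω] [Nonempty ↥Ω]
    (ρ₀ ρ₁ : Measure ↥Ω) [IsFiniteMeasure ρ₀] [IsFiniteMeasure ρ₁]
    {ρ : SignedMeasure (STt d Ω)} {m : Fin d → SignedMeasure (STt d Ω)}
    (hCE : CEeq d Ω ρ₀.toSignedMeasure ρ₁.toSignedMeasure ρ m)
    (φ ψ : C(↥Ω, ℝ)) (hle : ∀ x y, φ x + ψ y ≤ ‖(x : Euc d) - (y : Euc d)‖ ^ 2 / 2) :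
    ENNReal.ofReal (∫ x, φ x ∂ρ₀ + ∫ y, ψ y ∂ρ₁) ≤ actionBB ρ m := by
  set M := ρ₀.real univ + ρ₁.real univ with hM
  have key : ∀ ε : ℝ, 0 < ε →
      ENNReal.ofReal (∫ x, φ x ∂ρ₀ + ∫ y, ψ y ∂ρ₁ - ε * M) ≤ actionBB ρ m := by
    intro ε hε
    obtain ⟨u, hu, hsub, hu0, hu1⟩ := exists_hamiltonJacobi_subsolution φ ψ hle hε
    have hST : Continuous (STemb : STt d Ω → ℝ × Euc d) := by unfold STemb; fun_prop
    have hd : ∀ w, Continuous fun p : STt d Ω => fderiv ℝ u (STemb p) w := fun w =>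
      ((hu.continuous_fderiv one_ne_zero).comp hST).clm_apply continuous_const
    let a : C(STt d Ω, ℝ) := ⟨fun p => fderiv ℝ u (STemb p) (1, 0), hd _⟩
    let b : C(STt d Ω, Euc d) := ⟨fun p => WithLp.toLp 2 fun i =>
      fderiv ℝ u (STemb p) (0, EuclideanSpace.single i 1),
      (PiLp.continuous_toLp 2 _).comp (continuous_pi fun i => hd _)⟩
    have hact : ENNReal.ofReal (sInt ρ a + vInt m b) ≤ actionBB ρ m :=
      le_iSup (fun p : {q : C(STt d Ω, ℝ) × C(STt d Ω, Euc d) //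
        ∀ x, q.1 x + ‖q.2 x‖ ^ 2 / 2 ≤ 0} => ENNReal.ofReal (sInt ρ p.1.1 + vInt m p.1.2))
        ⟨(a, b), fun p => hsub _ _ p.1.2.1⟩
    refine le_trans (ENNReal.ofReal_le_ofReal ?_) hact
    have hfst : Continuous fun x : ↥Ω => u (0, (x : Euc d)) := hu.continuous.comp (by fun_prop)
    have hsnd : Continuous fun x : ↥Ω => u (1, (x : Euc d)) := hu.continuous.comp (by fun_prop)
    have hCEu : sInt ρ a + vInt m b = _ := hCE u hu
    rw [hCEu, sInt_toSignedMeasure _ (hsnd.integrable_of_compactSpace _),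
      sInt_toSignedMeasure _ (hfst.integrable_of_compactSpace _)]
    have hφ : Integrable (fun x => -φ x) ρ₀ := φ.continuous.neg.integrable_of_compactSpace ρ₀
    have hψ : Integrable (fun x => ψ x) ρ₁ := ψ.continuous.integrable_of_compactSpace ρ₁
    have h0 := integral_mono (hfst.integrable_of_compactSpace ρ₀)
      (hφ.add (integrable_const ε)) hu0
    have h1 := integral_mono (hψ.sub (integrable_const ε))
      (hsnd.integrable_of_compactSpace ρ₁) hu1
    rw [integral_add' hφ (integrable_const _), integral_neg, integral_const, smul_eq_mul] at h0
    rw [integral_sub' hψ (integrable_const _), integral_const, smul_eq_mul] at h1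
    rw [hM]
    linarith
  have hlim : Tendsto (fun ε : ℝ => ENNReal.ofReal (∫ x, φ x ∂ρ₀ + ∫ y, ψ y ∂ρ₁ - ε * M))
      (𝓝[>] 0) (𝓝 (ENNReal.ofReal (∫ x, φ x ∂ρ₀ + ∫ y, ψ y ∂ρ₁ - 0 * M))) :=
    ((ENNReal.continuous_ofReal.comp (by fun_prop)).tendsto 0).mono_left nhdsWithin_le_nhds
  rw [zero_mul, sub_zero] at hlim
  exact le_of_tendsto hlim (eventually_nhdsWithin_of_forall key)

end HamiltonJacobi

/-- An optimal coupling for the quadratic cost, whose cost is bounded by the action of all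
competitors in the dynamical problem. -/
theorem exists_optimal_coupling {d : ℕ} {Ω : Set (Euc d)} [CompactSpace ↥Ω] [Nonempty ↥Ω]
    (ρ₀ ρ₁ : Measure ↥Ω) [IsFiniteMeasure ρ₀] [IsFiniteMeasure ρ₁]
    (hmass : ρ₀ univ = ρ₁ univ) :
    ∃ π : Measure (↥Ω × ↥Ω), IsFiniteMeasure π ∧ π.map Prod.fst = ρ₀ ∧ π.map Prod.snd = ρ₁ ∧
      W2 ρ₀ ρ₁ ^ 2 = ∫ p, ‖(p.1 : Euc d) - (p.2 : Euc d)‖ ^ 2 ∂π ∧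
      ∀ (ρ : SignedMeasure (STt d Ω)) (m : Fin d → SignedMeasure (STt d Ω)),
        CEeq d Ω ρ₀.toSignedMeasure ρ₁.toSignedMeasure ρ m →
        ENNReal.ofReal ((∫ p, ‖(p.1 : Euc d) - (p.2 : Euc d)‖ ^ 2 ∂π) / 2) ≤ actionBB ρ m := by
  let c : C(↥Ω × ↥Ω, ℝ) := ⟨fun p => ‖(p.1 : Euc d) - (p.2 : Euc d)‖ ^ 2 / 2, by fun_prop⟩
  obtain ⟨π, hπ, h₀, h₁, hB⟩ := exists_coupling_forall_dual_le ρ₀ ρ₁ hmass c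
  have hcost : ∀ κ : Measure (↥Ω × ↥Ω), ∫ p, c p ∂κ =
      (∫ p, ‖(p.1 : Euc d) - (p.2 : Euc d)‖ ^ 2 ∂κ) / 2 := fun κ => integral_div _ _
  refine ⟨π, hπ, h₀, h₁, ?_, fun ρ m hCE => ?_⟩
  · have hleast : IsLeast {r : ℝ | ∃ κ : Measure (↥Ω × ↥Ω), IsFiniteMeasure κ ∧
        κ.map Prod.fst = ρ₀ ∧ κ.map Prod.snd = ρ₁ ∧
        r = ∫ p, ‖(p.1 : Euc d) - (p.2 : Euc d)‖ ^ 2 ∂κ}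
        (∫ p, ‖(p.1 : Euc d) - (p.2 : Euc d)‖ ^ 2 ∂π) := by
      refine ⟨⟨π, hπ, h₀, h₁, rfl⟩, ?_⟩
      rintro _ ⟨κ, hκ, hκ₀, hκ₁, rfl⟩
      have := hB (∫ p, c p ∂κ) fun φ ψ hle => by
        have hφ : Integrable (fun p : ↥Ω × ↥Ω => φ p.1) κ :=
          (φ.continuous.comp continuous_fst).integrable_of_compactSpace κ
        have hψ : Integrable (fun p : ↥Ω × ↥Ω => ψ p.2) κ :=
          (ψ.continuous.comp continuous_snd).integrable_of_compactSpace κ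
        rw [← hκ₀, ← hκ₁, integral_map measurable_fst.aemeasurable
          φ.continuous.aestronglyMeasurable, integral_map measurable_snd.aemeasurable
          ψ.continuous.aestronglyMeasurable, ← integral_add hφ hψ]
        exact integral_mono (hφ.add hψ)
          (c.continuous.integrable_of_compactSpace κ) fun p => hle p.1 p.2
      rw [hcost, hcost] at this
      linarith
    rw [W2, hleast.csInf_eq, Real.sq_sqrt (integral_nonneg fun p => sq_nonneg _)]
  · rw [← hcost]
    by_cases htop : actionBB ρ m = ⊤
    · simp [htop]
    · rw [ENNReal.ofReal_le_iff_le_toReal htop]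
      exact hB _ fun φ ψ hle => (ENNReal.ofReal_le_iff_le_toReal htop).1
        (ofReal_dual_le_actionBB ρ₀ ρ₁ hCE φ ψ hle)

/-- Benamou-Brenier / Wasserstein: for `ρ₀, ρ₁ ∈ M₊(Ω)` with the same total mass, the
functional `J_{ρ₀,ρ₁}` attains its infimum, and its minimal value is `(1/2)·W₂(ρ₀,ρ₁)²`. -/
theorem stmt0 {d : ℕ} (hd : 1 ≤ d) (Ω : Set (Euc d)) (hne : Ω.Nonempty)
    (hcomp : IsCompact Ω) (hconv : Convex ℝ Ω)
    (ρ₀ ρ₁ : Measure ↥Ω) [IsFiniteMeasure ρ₀] [IsFiniteMeasure ρ₁]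
    (hmass : ρ₀ Set.univ = ρ₁ Set.univ) :
    ∃ (ρ : SignedMeasure (STt d Ω)) (m : Fin d → SignedMeasure (STt d Ω)),
      (∀ (ρ' : SignedMeasure (STt d Ω)) (m' : Fin d → SignedMeasure (STt d Ω)),
        Jfun d Ω ρ₀.toSignedMeasure ρ₁.toSignedMeasure ρ m ≤
          Jfun d Ω ρ₀.toSignedMeasure ρ₁.toSignedMeasure ρ' m') ∧
      Jfun d Ω ρ₀.toSignedMeasure ρ₁.toSignedMeasure ρ m =
        ENNReal.ofReal (W2 ρ₀ ρ₁ ^ 2 / 2) := by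
  have := isCompact_iff_compactSpace.1 hcomp
  have := hne.to_subtype
  obtain ⟨π, hπ, h₀, h₁, hW, hlower⟩ := exists_optimal_coupling ρ₀ ρ₁ hmass
  obtain ⟨ρ, m, hCE, hupper⟩ := exists_CEeq_actionBB_le hconv ρ₀ ρ₁ π h₀ h₁
  have hJ : Jfun d Ω ρ₀.toSignedMeasure ρ₁.toSignedMeasure ρ m =
      ENNReal.ofReal (W2 ρ₀ ρ₁ ^ 2 / 2) := by
    rw [Jfun, if_pos hCE, hW]
    exact le_antisymm hupper (hlower ρ m hCE)
  refine ⟨ρ, m, fun ρ' m' => ?_, hJ⟩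
  rw [hJ, Jfun]
  split_ifs with hCE'
  · rw [hW]
    exact hlower ρ' m' hCE'
  · exact le_top

end
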